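/- Let G be a discrete group. A nonempty proper subset A ⊂ G is symmetrically right syndetic if and only if the characteristic function 1_A is a minimal point of the Bernoulli shift 2^G. -/

import Mathlib

/-- `S` is right syndetic in `G`: there is a finite set `F ⊆ G` with `G = F * S`. -/
def RightSyndetic {G : Type*} [Group G] (S : Set G) : Prop :=
  ∃ F : Finset G, ∀ g : G, ∃ f ∈ F, f⁻¹ * g ∈ S

/-- `A ⊆ G` is symmetrically right syndetic: for all finite `F₁ ⊆ A` and `F₂ ⊆ Aᶜ`, the
set `(⋂_{f ∈ F₁} f⁻¹A) ∩ (⋂_{f ∈ F₂} f⁻¹Aᶜ)` is right syndetic. -/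
def SymmRightSyndetic {G : Type*} [Group G] (A : Set G) : Prop :=
  ∀ F₁ F₂ : Finset G, ↑F₁ ⊆ A → ↑F₂ ⊆ Aᶜ →
    RightSyndetic ((⋂ f ∈ F₁, (f * ·) ⁻¹' A) ∩ ⋂ f ∈ F₂, (f * ·) ⁻¹' Aᶜ)

/-- The Bernoulli shift action of `G` on `2^G = G → Bool`, given by `(g • x) h = x (h * g)`. -/
instance bernSMul (G : Type*) [Group G] : SMul G (G → Bool) :=
  ⟨fun g x h => x (h * g)⟩

instance bernMulAction (G : Type*) [Group G] : MulAction G (G → Bool) where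
  one_smul x := funext fun h => congrArg x (mul_one h)
  mul_smul g g' x := funext fun h => (congrArg x (mul_assoc h g g')).symm

/-- A point `x` of a `G`-space is a minimal point if its orbit closure is a minimal
system, i.e. every point of the orbit closure of `x` has the same orbit closure. -/
def IsMinimalPoint (G : Type*) [Group G] {X : Type*} [TopologicalSpace X] [MulAction G X]
    (x : X) : Prop :=
  ∀ y ∈ closure (MulAction.orbit G x),
    closure (MulAction.orbit G y) = closure (MulAction.orbit G x)

theorem bern_apply {G : Type*} [Group G] (g : G) (x : G → Bool) (h : G) :
    (g • x) h = x (h * g) := rfl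

theorem bern_cont {G : Type*} [Group G] (g : G) : Continuous (fun x : G → Bool => g • x) :=
  continuous_pi fun h => continuous_apply (h * g)

theorem bern_smul_mem {G : Type*} [Group G] (x y : G → Bool) (g : G)
    (hy : y ∈ closure (MulAction.orbit G x)) : g • y ∈ closure (MulAction.orbit G x) := by
  refine map_mem_closure (bern_cont g) hy ?_
  rintro _ ⟨k, rfl⟩
  exact ⟨g * k, mul_smul g k x⟩

theorem bern_closure_sub {G : Type*} [Group G] (x y : G → Bool)
    (hy : y ∈ closure (MulAction.orbit G x)) :
    closure (MulAction.orbit G y) ⊆ closure (MulAction.orbit G x) := by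
  refine closure_minimal ?_ isClosed_closure
  rintro _ ⟨k, rfl⟩
  exact bern_smul_mem x y k hy

theorem bern_coord_clopen {G : Type*} (i : G) (b : Bool) : IsClopen {z : G → Bool | z i = b} :=
  (isClopen_discrete {b}).preimage (continuous_apply i)

/-- Let `G` be a discrete group. A nonempty proper subset `A ⊆ G` is symmetrically right
syndetic iff its characteristic function `1_A` is a minimal point of the Bernoulli
shift `2^G`. -/
theorem stmt18 (G : Type*) [Group G] (A : Set G) (h1 : A.Nonempty) (h2 : A ≠ Set.univ) :
    SymmRightSyndetic A ↔ IsMinimalPoint G (A.boolIndicator) := by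
  classical
  have hT : ∀ g, A.boolIndicator g = true ↔ g ∈ A := fun g => (A.mem_iff_boolIndicator g).symm
  have hF : ∀ g, A.boolIndicator g = false ↔ g ∉ A := fun g => (A.notMem_iff_boolIndicator g).symm
  set x := A.boolIndicator with hx
  constructor
  · intro hA y hy
    refine (bern_closure_sub x y hy).antisymm (bern_closure_sub y x ?_)
    rw [mem_closure_iff]
    intro o ho hxo
    obtain ⟨I, u, hu, hsub⟩ := isOpen_pi_iff.1 ho x hxo
    obtain ⟨F, hFs⟩ := hA (I.filter (· ∈ A)) (I.filter (· ∉ A))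
      (fun i hi => (Finset.mem_filter.1 hi).2) (fun i hi => (Finset.mem_filter.1 hi).2)
    have hcl : IsClosed (⋃ f ∈ F, ⋂ i ∈ I, {z : G → Bool | z (i * f⁻¹) = x i}) :=
      F.finite_toSet.isClosed_biUnion fun f _ =>
        isClosed_biInter fun i _ => (bern_coord_clopen (i * f⁻¹) (x i)).1
    have hyc := closure_minimal (s := MulAction.orbit G x) ?_ hcl hy
    · simp only [Set.mem_iUnion, Set.mem_iInter, Set.mem_ofPred_eq] at hyc
      obtain ⟨f, _, hf⟩ := hyc
      refine ⟨f⁻¹ • y, hsub fun i hi => ?_, ⟨f⁻¹, rfl⟩⟩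
      rw [bern_apply, hf i hi]
      exact (hu i hi).2
    · rintro _ ⟨g, rfl⟩
      obtain ⟨f, hf, h3, h4⟩ := hFs g
      simp only [Set.mem_iInter, Set.mem_preimage, Finset.mem_filter, Set.mem_compl_iff] at h3 h4
      simp only [Set.mem_iUnion, Set.mem_iInter, Set.mem_ofPred_eq]
      refine ⟨f, hf, fun i hi => ?_⟩
      change x (i * f⁻¹ * g) = x i
      rw [mul_assoc]
      by_cases hiA : i ∈ A
      · rw [(hT i).2 hiA, hT]; exact h3 i ⟨hi, hiA⟩
      · rw [(hF i).2 hiA, hF]; exact h4 i ⟨hi, hiA⟩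
  · intro hm F₁ F₂ hF₁ hF₂
    let U : Set (G → Bool) :=
      (⋂ i ∈ F₁, {z : G → Bool | z i = true}) ∩ ⋂ i ∈ F₂, {z : G → Bool | z i = false}
    have hU : IsOpen U :=
      (isOpen_biInter_finset fun i _ => (bern_coord_clopen i true).2).inter
        (isOpen_biInter_finset fun i _ => (bern_coord_clopen i false).2)
    have hxU : x ∈ U := by
      simp only [U, Set.mem_inter_iff, Set.mem_iInter, Set.mem_ofPred_eq]
      exact ⟨fun i hi => (hT i).2 (hF₁ hi), fun i hi => (hF i).2 (hF₂ hi)⟩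
    have hK : IsCompact (closure (MulAction.orbit G x)) := isClosed_closure.isCompact
    obtain ⟨t, ht⟩ := hK.elim_finite_subcover (fun g : G => (fun z : G → Bool => g • z) ⁻¹' U)
      (fun g => hU.preimage (bern_cont g)) (by
        intro y hy
        have : x ∈ closure (MulAction.orbit G y) := by
          rw [hm y hy]; exact subset_closure ⟨1, one_smul G x⟩
        obtain ⟨_, hz, ⟨g, rfl⟩⟩ := mem_closure_iff.1 this U hU hxU
        exact Set.mem_iUnion.2 ⟨g, hz⟩)
    refine ⟨t.image (·⁻¹), fun g => ?_⟩
    have := ht (subset_closure (MulAction.mem_orbit x g))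
    simp only [Set.mem_iUnion] at this
    obtain ⟨k, hk, h3, h4⟩ := this
    refine ⟨k⁻¹, Finset.mem_image_of_mem _ hk, ?_⟩
    simp only [Set.mem_iInter, Set.mem_ofPred_eq, bern_apply, mul_assoc, hT, hF] at h3 h4
    simp only [Set.mem_inter_iff, Set.mem_iInter, Set.mem_preimage, Set.mem_compl_iff, inv_inv]
    exact ⟨h3, h4⟩
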